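/- (Lemma 2.1) Let x ∈ B(φ,δ) and v_1, v_2 ∈ X. Then the function s ↦ K''(x)(v_1,v_2)(s) is differentiable on [0,1], its derivative equals ∫_0^s (∂q_1/∂s)(s,t,x(t)) v_1(t) v_2(t) dt + ∫_s^1 (∂q_2/∂s)(s,t,x(t)) v_1(t) v_2(t) dt, and ‖(K''(x)(v_1,v_2))'‖_∞ ≤ C_3 ‖v_1‖_∞ ‖v_2‖_∞. -/

import Mathlib

set_option linter.unusedVariables false

open MeasureTheory Set Filter Topology

/-- Differentiation under the integral sign over `[a, b]`, within `[a, b]`, at a point `s` where the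
derivative of the integrand is given by different formulas on the two sides of `s`. -/
theorem hasDerivWithinAt_integral_of_lipschitz_split {a b C s : ℝ} {G : ℝ → ℝ → ℝ} {D₁ D₂ : ℝ → ℝ}
    (hs : s ∈ Icc a b)
    (hint : ∀ w ∈ Icc a b, IntervalIntegrable (G w) volume a b)
    (hlip : ∀ w ∈ Icc a b, ∀ t ∈ Icc a b, |G w t - G s t| ≤ C * |w - s|)
    (hD₁ : ∀ t ∈ Ico a s, HasDerivWithinAt (fun w => G w t) (D₁ t) (Icc a b) s)
    (hD₂ : ∀ t ∈ Ioc s b, HasDerivWithinAt (fun w => G w t) (D₂ t) (Icc a b) s) :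
    HasDerivWithinAt (fun w => ∫ t in a..b, G w t)
      ((∫ t in a..s, D₁ t) + ∫ t in s..b, D₂ t) (Icc a b) s := by
  have hab : a ≤ b := hs.1.trans hs.2
  have hl : uIcc a s ⊆ uIcc a b := by
    rw [uIcc_of_le hs.1, uIcc_of_le hab]; exact Icc_subset_Icc_right hs.2
  have hr : uIcc s b ⊆ uIcc a b := by
    rw [uIcc_of_le hs.2, uIcc_of_le hab]; exact Icc_subset_Icc_left hs.1
  have hslope : ∀ w ∈ Icc a b,
      IntervalIntegrable (fun t => slope (fun w => G w t) s w) volume a b := by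
    intro w hw
    simp only [slope_def_field]
    exact ((hint w hw).sub (hint s hs)).div_const _
  have hmem : ∀ᶠ w in 𝓝[Icc a b \ {s}] s, w ∈ Icc a b \ {s} := self_mem_nhdsWithin
  have hbound : ∀ w ∈ Icc a b \ {s}, ∀ t ∈ Icc a b, ‖slope (fun w => G w t) s w‖ ≤ C := by
    intro w hw t ht
    have hne : w - s ≠ 0 := sub_ne_zero.2 hw.2
    rw [slope_def_field, Real.norm_eq_abs, abs_div, div_le_iff₀ (abs_pos.2 hne)]
    exact hlip w hw.1 t ht
  have hlim : ∀ c d : ℝ, c ≤ d → uIcc c d ⊆ uIcc a b → ∀ D : ℝ → ℝ,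
      (∀ᵐ t, t ∈ uIoc c d → HasDerivWithinAt (fun w => G w t) (D t) (Icc a b) s) →
      Tendsto (fun w => ∫ t in c..d, slope (fun w => G w t) s w) (𝓝[Icc a b \ {s}] s)
        (𝓝 (∫ t in c..d, D t)) := by
    intro c d hcd hsub D hD
    refine intervalIntegral.tendsto_integral_filter_of_dominated_convergence (fun _ => C) ?_ ?_ ?_ ?_
    · filter_upwards [hmem] with w hw
      exact ((hslope w hw.1).mono_set hsub).def'.aestronglyMeasurable
    · filter_upwards [hmem] with w hw
      refine Eventually.of_forall fun t ht => hbound w hw t ?_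
      have := hsub (uIoc_subset_uIcc ht)
      rwa [uIcc_of_le hab] at this
    · exact intervalIntegrable_const
    · filter_upwards [hD] with t ht hmt
      exact hasDerivWithinAt_iff_tendsto_slope.1 (ht hmt)
  have hne : ∀ᵐ t : ℝ, t ≠ s := by simp [ae_iff]
  rw [hasDerivWithinAt_iff_tendsto_slope]
  refine Tendsto.congr' ?_ ((hlim a s hs.1 hl D₁ ?_).add (hlim s b hs.2 hr D₂ ?_))
  · filter_upwards [hmem] with w hw
    rw [intervalIntegral.integral_add_adjacent_intervals ((hslope w hw.1).mono_set hl)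
      ((hslope w hw.1).mono_set hr)]
    simp only [slope_def_field]
    rw [intervalIntegral.integral_div, intervalIntegral.integral_sub (hint w hw.1) (hint s hs)]
  · filter_upwards [hne] with t ht hmt
    rw [uIoc_of_le hs.1] at hmt
    exact hD₁ t ⟨hmt.1.le, lt_of_le_of_ne hmt.2 ht⟩
  · filter_upwards with t hmt
    rw [uIoc_of_le hs.2] at hmt
    exact hD₂ t hmt

/-- A function on `[a, b]` with derivative bounded by `C` on both sides of a point `t` is
`C`-Lipschitz. -/
theorem abs_sub_le_of_hasDerivWithinAt_split {a b C t : ℝ} {g g₁ g₂ : ℝ → ℝ} (ht : t ∈ Icc a b)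
    (h₁ : ∀ w ∈ Icc t b, HasDerivWithinAt g (g₁ w) (Icc t b) w)
    (h₂ : ∀ w ∈ Icc a t, HasDerivWithinAt g (g₂ w) (Icc a t) w)
    (hC₁ : ∀ w ∈ Icc t b, |g₁ w| ≤ C) (hC₂ : ∀ w ∈ Icc a t, |g₂ w| ≤ C)
    {w s : ℝ} (hw : w ∈ Icc a b) (hs : s ∈ Icc a b) : |g w - g s| ≤ C * |w - s| := by
  wlog hsw : s ≤ w generalizing w s
  · rw [abs_sub_comm, abs_sub_comm w]
    exact this hs hw (le_of_not_ge hsw)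
  have hR : ∀ p ∈ Icc t b, ∀ q ∈ Icc t b, |g q - g p| ≤ C * |q - p| := fun p hp q hq =>
    (convex_Icc t b).norm_image_sub_le_of_norm_hasDerivWithin_le h₁ hC₁ hp hq
  have hL : ∀ p ∈ Icc a t, ∀ q ∈ Icc a t, |g q - g p| ≤ C * |q - p| := fun p hp q hq =>
    (convex_Icc a t).norm_image_sub_le_of_norm_hasDerivWithin_le h₂ hC₂ hp hq
  rcases le_total t s with hts | hts
  · exact hR s ⟨hts, hs.2⟩ w ⟨hts.trans hsw, hw.2⟩
  rcases le_total t w with htw | htw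
  · have e₁ := hR t ⟨le_rfl, ht.2⟩ w ⟨htw, hw.2⟩
    have e₂ := hL s ⟨hs.1, hts⟩ t ⟨ht.1, le_rfl⟩
    rw [abs_of_nonneg (sub_nonneg.2 htw)] at e₁
    rw [abs_of_nonneg (sub_nonneg.2 hts)] at e₂
    rw [abs_of_nonneg (sub_nonneg.2 hsw)]
    have := abs_sub_le (g w) (g t) (g s)
    linarith
  · exact hL s ⟨hs.1, hts⟩ w ⟨hw.1, htw⟩

theorem stmt_7
    (r : ℕ) (hr : 1 ≤ r)
    (κ : ℝ → ℝ → ℝ → ℝ) (κu : ℕ → ℝ → ℝ → ℝ → ℝ)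
    (hκ0 : κu 0 = κ)
    (hκu : ∀ i ≤ 3, ∀ s t u : ℝ, HasDerivAt (fun w => κu i s t w) (κu (i+1) s t u) u)
    (hκcont : ∀ i ≤ 4, Continuous fun p : ℝ × ℝ × ℝ => κu i p.1 p.2.1 p.2.2)
    (κ1 κ2 ℓ1 ℓ2 q1 q2 : ℝ → ℝ → ℝ → ℝ)
    (hκ1smooth : ContDiffOn ℝ (r : ℕ∞) (fun p : ℝ × ℝ × ℝ => κ1 p.1 p.2.1 p.2.2)
      {p : ℝ × ℝ × ℝ | 0 ≤ p.2.1 ∧ p.2.1 ≤ p.1 ∧ p.1 ≤ 1})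
    (hκ2smooth : ContDiffOn ℝ (r : ℕ∞) (fun p : ℝ × ℝ × ℝ => κ2 p.1 p.2.1 p.2.2)
      {p : ℝ × ℝ × ℝ | 0 ≤ p.1 ∧ p.1 ≤ p.2.1 ∧ p.2.1 ≤ 1})
    (hℓ1smooth : ContDiffOn ℝ (r : ℕ∞) (fun p : ℝ × ℝ × ℝ => ℓ1 p.1 p.2.1 p.2.2)
      {p : ℝ × ℝ × ℝ | 0 ≤ p.2.1 ∧ p.2.1 ≤ p.1 ∧ p.1 ≤ 1})
    (hℓ2smooth : ContDiffOn ℝ (r : ℕ∞) (fun p : ℝ × ℝ × ℝ => ℓ2 p.1 p.2.1 p.2.2)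
      {p : ℝ × ℝ × ℝ | 0 ≤ p.1 ∧ p.1 ≤ p.2.1 ∧ p.2.1 ≤ 1})
    (hq1smooth : ContDiffOn ℝ (r : ℕ∞) (fun p : ℝ × ℝ × ℝ => q1 p.1 p.2.1 p.2.2)
      {p : ℝ × ℝ × ℝ | 0 ≤ p.2.1 ∧ p.2.1 ≤ p.1 ∧ p.1 ≤ 1})
    (hq2smooth : ContDiffOn ℝ (r : ℕ∞) (fun p : ℝ × ℝ × ℝ => q2 p.1 p.2.1 p.2.2)
      {p : ℝ × ℝ × ℝ | 0 ≤ p.1 ∧ p.1 ≤ p.2.1 ∧ p.2.1 ≤ 1})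
    (hκeq1 : ∀ s t u : ℝ, 0 ≤ t → t ≤ s → s ≤ 1 → κ s t u = κ1 s t u)
    (hκeq2 : ∀ s t u : ℝ, 0 ≤ s → s ≤ t → t ≤ 1 → κ s t u = κ2 s t u)
    (hℓeq1 : ∀ s t u : ℝ, 0 ≤ t → t ≤ s → s ≤ 1 → κu 1 s t u = ℓ1 s t u)
    (hℓeq2 : ∀ s t u : ℝ, 0 ≤ s → s ≤ t → t ≤ 1 → κu 1 s t u = ℓ2 s t u)
    (hqeq1 : ∀ s t u : ℝ, 0 ≤ t → t ≤ s → s ≤ 1 → κu 2 s t u = q1 s t u)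
    (hqeq2 : ∀ s t u : ℝ, 0 ≤ s → s ≤ t → t ≤ 1 → κu 2 s t u = q2 s t u)
    (f φ : ℝ → ℝ) (hφc : Continuous φ) (hfm : Measurable f)
    (K : (ℝ → ℝ) → ℝ → ℝ)
    (hK : ∀ (x : ℝ → ℝ) (s : ℝ), K x s = ∫ t in (0:ℝ)..1, κ s t (x t))
    (hφsol : ∀ s ∈ Set.Icc (0:ℝ) 1, φ s - K φ s = f s)
    (K1 : (ℝ → ℝ) → ℝ → ℝ)
    (hK1 : ∀ (v : ℝ → ℝ) (s : ℝ), K1 v s = ∫ t in (0:ℝ)..1, κu 1 s t (φ t) * v t)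
    (hnoteig : ∀ v : ℝ → ℝ, Continuous v → (∀ s ∈ Set.Icc (0:ℝ) 1, K1 v s = v s) →
      ∀ s ∈ Set.Icc (0:ℝ) 1, v s = 0)
    (δ : ℝ) (hδ : 0 < δ)
    (Mφb : ℝ) (hMφb : ∀ t ∈ Set.Icc (0:ℝ) 1, |φ t| ≤ Mφb)
    (q1s q2s : ℝ → ℝ → ℝ → ℝ)
    (hq1s : ∀ s t u : ℝ, 0 ≤ t → t ≤ s → s ≤ 1 →
      HasDerivWithinAt (fun w => q1 w t u) (q1s s t u) (Set.Icc t 1) s)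
    (hq2s : ∀ s t u : ℝ, 0 ≤ s → s ≤ t → t ≤ 1 →
      HasDerivWithinAt (fun w => q2 w t u) (q2s s t u) (Set.Icc 0 t) s)
    (C3 : ℝ)
    (hC3a : ∀ s t u : ℝ, 0 ≤ t → t ≤ s → s ≤ 1 → |u| ≤ Mφb + δ → |q1s s t u| ≤ C3)
    (hC3b : ∀ s t u : ℝ, 0 ≤ s → s ≤ t → t ≤ 1 → |u| ≤ Mφb + δ → |q2s s t u| ≤ C3)
    (x v1 v2 : ℝ → ℝ) (hxm : Measurable x) (hv1m : Measurable v1) (hv2m : Measurable v2)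
    (hxnear : ∀ t ∈ Set.Icc (0:ℝ) 1, |x t - φ t| ≤ δ)
    (B1 B2 : ℝ)
    (hB1 : ∀ t ∈ Set.Icc (0:ℝ) 1, |v1 t| ≤ B1)
    (hB2 : ∀ t ∈ Set.Icc (0:ℝ) 1, |v2 t| ≤ B2)
    :
    (∀ s ∈ Set.Icc (0:ℝ) 1,
      HasDerivWithinAt (fun w => ∫ t in (0:ℝ)..1, κu 2 w t (x t) * v1 t * v2 t)
        ((∫ t in (0:ℝ)..s, q1s s t (x t) * v1 t * v2 t)
          + ∫ t in s..(1:ℝ), q2s s t (x t) * v1 t * v2 t) (Set.Icc (0:ℝ) 1) s)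
    ∧ ∀ s ∈ Set.Icc (0:ℝ) 1,
        |(∫ t in (0:ℝ)..s, q1s s t (x t) * v1 t * v2 t)
          + ∫ t in s..(1:ℝ), q2s s t (x t) * v1 t * v2 t| ≤ C3 * B1 * B2 := by
  have hxb : ∀ t ∈ Icc (0:ℝ) 1, |x t| ≤ Mφb + δ := by
    intro t ht
    have h₁ := hxnear t ht
    have h₂ := hMφb t ht
    have h₃ := abs_add_le (φ t) (x t - φ t)
    rw [add_sub_cancel] at h₃
    linarith
  have hz : (0:ℝ) ∈ Icc (0:ℝ) 1 := ⟨le_rfl, zero_le_one⟩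
  have hC3 : 0 ≤ C3 :=
    (abs_nonneg _).trans (hC3a 0 0 (x 0) le_rfl le_rfl zero_le_one (hxb 0 hz))
  have hB1' : 0 ≤ B1 := (abs_nonneg _).trans (hB1 0 hz)
  have hB2' : 0 ≤ B2 := (abs_nonneg _).trans (hB2 0 hz)
  have hmul : ∀ A c : ℝ, |c| ≤ A → ∀ t ∈ Icc (0:ℝ) 1, |c * v1 t * v2 t| ≤ A * B1 * B2 := by
    intro A c hc t ht
    have hA : 0 ≤ A := (abs_nonneg _).trans hc
    rw [abs_mul, abs_mul]
    gcongr
    · exact hB1 t ht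
    · exact hB2 t ht
  have hd₁ : ∀ s t u : ℝ, 0 ≤ t → t ≤ s → s ≤ 1 →
      HasDerivWithinAt (fun w => κu 2 w t u) (q1s s t u) (Icc t 1) s := fun s t u h0 hts h1 =>
    (hq1s s t u h0 hts h1).congr (fun w hw => hqeq1 w t u h0 hw.1 hw.2) (hqeq1 s t u h0 hts h1)
  have hd₂ : ∀ s t u : ℝ, 0 ≤ s → s ≤ t → t ≤ 1 →
      HasDerivWithinAt (fun w => κu 2 w t u) (q2s s t u) (Icc 0 t) s := fun s t u h0 hst h1 =>
    (hq2s s t u h0 hst h1).congr (fun w hw => hqeq2 w t u hw.1 hw.2 h1) (hqeq2 s t u h0 hst h1)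
  have hc2 := hκcont 2 (by norm_num)
  have hint : ∀ w ∈ Icc (0:ℝ) 1,
      IntervalIntegrable (fun t => κu 2 w t (x t) * v1 t * v2 t) volume 0 1 := by
    intro w _
    have hcw : Continuous fun p : ℝ × ℝ => κu 2 w p.1 p.2 :=
      hc2.comp (continuous_const.prodMk continuous_id)
    obtain ⟨A, hA⟩ := ((isCompact_Icc (a := (0:ℝ)) (b := 1)).prod
      (isCompact_Icc (a := -(Mφb + δ)) (b := Mφb + δ))).exists_bound_of_continuousOn
      hcw.continuousOn
    have hmeas : Measurable fun t => κu 2 w t (x t) * v1 t * v2 t :=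
      ((hcw.measurable.comp (measurable_id.prodMk hxm)).mul hv1m).mul hv2m
    refine (intervalIntegrable_const (c := A * B1 * B2)).mono_fun hmeas.aestronglyMeasurable ?_
    filter_upwards [ae_restrict_mem measurableSet_uIoc] with t ht
    rw [uIoc_of_le zero_le_one] at ht
    have ht' := Ioc_subset_Icc_self ht
    refine le_trans ?_ (le_abs_self _)
    exact hmul A _ (hA (t, x t) ⟨ht', abs_le.1 (hxb t ht')⟩) t ht'
  refine ⟨fun s hs => ?_, fun s hs => ?_⟩
  · refine hasDerivWithinAt_integral_of_lipschitz_split (C := C3 * B1 * B2) hs hint ?_ ?_ ?_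
    · intro w hw t ht
      have h := abs_sub_le_of_hasDerivWithinAt_split (C := C3) ht
        (fun w hw => hd₁ w t (x t) ht.1 hw.1 hw.2) (fun w hw => hd₂ w t (x t) hw.1 hw.2 ht.2)
        (fun w hw => hC3a w t (x t) ht.1 hw.1 hw.2 (hxb t ht))
        (fun w hw => hC3b w t (x t) hw.1 hw.2 ht.2 (hxb t ht)) hw hs
      have := hmul _ _ h t ht
      calc _ = |(κu 2 w t (x t) - κu 2 s t (x t)) * v1 t * v2 t| := by ring_nf
        _ ≤ _ := this
        _ = _ := by ring
    · intro t ht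
      refine (((hd₁ s t (x t) ht.1 ht.2.le hs.2).mul_const _).mul_const _).mono_of_mem_nhdsWithin ?_
      filter_upwards [self_mem_nhdsWithin, mem_nhdsWithin_of_mem_nhds (Ioi_mem_nhds ht.2)]
        with w hw hw'
      exact ⟨le_of_lt hw', hw.2⟩
    · intro t ht
      refine (((hd₂ s t (x t) hs.1 ht.1.le ht.2).mul_const _).mul_const _).mono_of_mem_nhdsWithin ?_
      filter_upwards [self_mem_nhdsWithin, mem_nhdsWithin_of_mem_nhds (Iio_mem_nhds ht.1)]
        with w hw hw'
      exact ⟨hw.1, le_of_lt hw'⟩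
  · have e₁ : |∫ t in (0:ℝ)..s, q1s s t (x t) * v1 t * v2 t| ≤ C3 * B1 * B2 * |s - 0| := by
      rw [← Real.norm_eq_abs]
      refine intervalIntegral.norm_integral_le_of_norm_le_const fun t ht => ?_
      rw [uIoc_of_le hs.1] at ht
      have ht' : t ∈ Icc (0:ℝ) 1 := ⟨ht.1.le, ht.2.trans hs.2⟩
      exact hmul C3 _ (hC3a s t (x t) ht'.1 ht.2 hs.2 (hxb t ht')) t ht'
    have e₂ : |∫ t in s..(1:ℝ), q2s s t (x t) * v1 t * v2 t| ≤ C3 * B1 * B2 * |1 - s| := by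
      rw [← Real.norm_eq_abs]
      refine intervalIntegral.norm_integral_le_of_norm_le_const fun t ht => ?_
      rw [uIoc_of_le hs.2] at ht
      have ht' : t ∈ Icc (0:ℝ) 1 := ⟨hs.1.trans ht.1.le, ht.2⟩
      exact hmul C3 _ (hC3b s t (x t) hs.1 ht.1.le ht.2 (hxb t ht')) t ht'
    rw [abs_of_nonneg (sub_nonneg.2 hs.1)] at e₁
    rw [abs_of_nonneg (sub_nonneg.2 hs.2)] at e₂
    refine (abs_add_le _ _).trans ((add_le_add e₁ e₂).trans_eq ?_)
    ring
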